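/- (General case.) Fix 𝐝 = (d₁,…,d_m) with d₁ ≥ d₂ ≥ … ≥ d_m ≥ 1, d = Σ_i d_i, and let r(𝐝) = ⌊d₁/d̂₁⌋ where d̂₁ = Σ_{j≠1} d_j. Let n ≥ 3, let the F_i be in general position, let λ_i be pairwise distinct and nonzero with Σ_i d_i λ_i = 0, and further assume e·λ₁ + λ_s ≠ 0 for all 1 ≤ e ≤ r(𝐝) and s ≠ 1; set ω = Σ_i λ_i F̂_i dF_i. If α is a projective homogeneous polynomial 1-form of degree d with ω ∧ dα + α ∧ dω = 0 and α = Σ_i F̂_i γ_i for some homogeneous 1-forms γ_i of degree d_i, then α = dμ(λ,F)(λ', F') where λ' ∈ ℂ^m satisfies Σ_i d_i λ'_i = 0, F'_j = 0 for j > 1, and F'₁ = Σ_{e=1}^{r(𝐝)} G_e · F̂₁^e for some homogeneous polynomials G_e of degree d₁ − e·d̂₁. In particular α lies in the image of dμ(λ, F). -/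

import Mathlib

open MvPolynomial Finset

namespace LogStab

/-- The polynomial ring `ℂ[x₀, …, x_{N-1}]`. -/
abbrev S (N : ℕ) : Type := MvPolynomial (Fin N) ℂ

/-- A polynomial 1-form `∑ₖ aₖ dxₖ` on `ℂ^N`, given by its coefficients `aₖ`. -/
abbrev Form1 (N : ℕ) : Type := Fin N → S N

/-- The differential `dF` of a polynomial, as a 1-form. -/
noncomputable def Dp {N : ℕ} (F : S N) : Form1 N := fun k => pderiv k F

/-- Exterior derivative of a 1-form: the antisymmetric coefficients of the 2-form `dω`,
`(dω)_{kl} = ∂ₖ ω_l - ∂_l ω_k`. -/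
noncomputable def extD {N : ℕ} (ω : Form1 N) : Fin N → Fin N → S N :=
  fun k l => pderiv k (ω l) - pderiv l (ω k)

/-- Wedge of two 1-forms: `(α ∧ β)_{kl} = αₖ β_l - α_l βₖ`. -/
noncomputable def w11 {N : ℕ} (α β : Form1 N) : Fin N → Fin N → S N :=
  fun k l => α k * β l - α l * β k

/-- Wedge of a 1-form and an (antisymmetric) 2-form: coefficients of the 3-form. -/
noncomputable def w12 {N : ℕ} (α : Form1 N) (β : Fin N → Fin N → S N) :
    Fin N → Fin N → Fin N → S N :=
  fun i j k => α i * β j k - α j * β i k + α k * β i j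

/-- Wedge of two (antisymmetric) 2-forms: coefficients of the 4-form. -/
noncomputable def w22 {N : ℕ} (β γ : Fin N → Fin N → S N) :
    Fin N → Fin N → Fin N → Fin N → S N :=
  fun i j k l =>
    β i j * γ k l - β i k * γ j l + β i l * γ j k + β j k * γ i l - β j l * γ i k + β k l * γ i j

/-- Contraction `⟨R, α⟩ = ∑ₖ xₖ aₖ` of a 1-form with the radial (Euler) vector field. -/
noncomputable def radial {N : ℕ} (α : Form1 N) : S N := ∑ k, X k * α k

/-- `α` is a homogeneous 1-form of degree `d`:
all its coefficients are homogeneous polynomials of degree `d - 1`. -/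
def IsHomog1 {N : ℕ} (α : Form1 N) (d : ℕ) : Prop := ∀ k, (α k).IsHomogeneous (d - 1)

/-- `F̂ᵢ = ∏_{j ≠ i} F_j`. -/
noncomputable def Fhat {N m : ℕ} (F : Fin m → S N) (i : Fin m) : S N :=
  ∏ j ∈ Finset.univ.erase i, F j

/-- `F̂ᵢⱼ = ∏_{k ≠ i, j} F_k`. -/
noncomputable def Fhat2 {N m : ℕ} (F : Fin m → S N) (i j : Fin m) : S N :=
  ∏ k ∈ (Finset.univ.erase i).erase j, F k

/-- The logarithmic 1-form `ω = μ(λ, F) = ∑ᵢ λᵢ F̂ᵢ dFᵢ`. -/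
noncomputable def logForm {N m : ℕ} (lam : Fin m → ℂ) (F : Fin m → S N) : Form1 N :=
  fun k => ∑ i, C (lam i) * Fhat F i * pderiv k (F i)

/-- The condition `ω ∧ dα + α ∧ dω = 0` (as a 3-form). -/
def TangentZero {N : ℕ} (ω α : Form1 N) : Prop :=
  ∀ i j k, w12 ω (extD α) i j k + w12 α (extD ω) i j k = 0

/-- The derivative of the multilinear map `μ` at `(λ, F)` in the direction `(λ', F')`:
`∑ᵢ λ'ᵢ F̂ᵢ dFᵢ + ∑_{i ≠ k} λᵢ F'ₖ F̂ᵢₖ dFᵢ + ∑ᵢ λᵢ F̂ᵢ dF'ᵢ`. -/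
noncomputable def dmu {N m : ℕ} (lam : Fin m → ℂ) (F : Fin m → S N)
    (lam' : Fin m → ℂ) (F' : Fin m → S N) : Form1 N :=
  fun k =>
    (∑ i, C (lam' i) * Fhat F i * pderiv k (F i)) +
    (∑ i, ∑ j ∈ Finset.univ.erase i, C (lam i) * F' j * Fhat2 F i j * pderiv k (F i)) +
    (∑ i, C (lam i) * Fhat F i * pderiv k (F' i))

/-- The `Fᵢ` are in general position: each `Fᵢ` is irreducible and at every nonzero point
of the cone the differentials of the `Fᵢ` vanishing there are linearly independent
(simple normal crossings; in particular each hypersurface is smooth). -/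
def GeneralPosition {N m : ℕ} (F : Fin m → S N) : Prop :=
  (∀ i, Irreducible (F i)) ∧
  ∀ x : Fin N → ℂ, x ≠ 0 →
    LinearIndependent ℂ (fun i : {i : Fin m // eval x (F i) = 0} =>
      (fun k => eval x (pderiv k (F i.1)) : Fin N → ℂ))

/-- A polynomial function on a complex vector space: an element of the subalgebra of
functions generated by the linear functionals. -/
def IsPolyFun {E : Type*} [AddCommGroup E] [Module ℂ E] (f : E → ℂ) : Prop :=
  f ∈ Algebra.adjoin ℂ {g : E → ℂ | IsLinearMap ℂ g}

/-- The Zariski topology on a complex vector space, generated by the basic open sets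
`{x | f x ≠ 0}` for `f` a polynomial function; closed sets are the common zero loci
of families of polynomial functions. -/
def zariskiTop (E : Type*) [AddCommGroup E] [Module ℂ E] : TopologicalSpace E :=
  TopologicalSpace.generateFrom {U | ∃ f : E → ℂ, IsPolyFun f ∧ U = {x | f x ≠ 0}}

section Depth

open CategoryTheory Abelian

/-- The ideal of the origin. -/
noncomputable def irrel (N : ℕ) : Ideal (S N) := Ideal.span (Set.range X)

/-- `M` has depth at least `t` at the origin, expressed through vanishing of `Ext`. -/
def DepthGE {N : ℕ} (t : ℕ) (M : Type) [AddCommGroup M] [Module (S N) M] : Prop :=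
  ∀ L : ModuleCat.{0} (S N), Module.Finite (S N) L →
    Module.support (S N) L ⊆ PrimeSpectrum.zeroLocus (irrel N) →
    ∀ i < t, Subsingleton (Ext L (ModuleCat.of (S N) M) i)

variable {N : ℕ} {A B Q : Type} [AddCommGroup A] [Module (S N) A] [AddCommGroup B] [Module (S N) B]
  [AddCommGroup Q] [Module (S N) Q]

lemma DepthGE.mono {s t : ℕ} (hst : s ≤ t) (h : DepthGE (N := N) t A) : DepthGE (N := N) s A :=
  fun L hL hs i hi => h L hL hs i (hi.trans_le hst)

lemma shortExact_of_linearMap (f : A →ₗ[S N] B) (g : B →ₗ[S N] Q) (hf : Function.Injective f)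
    (hg : Function.Surjective g) (hfg : Function.Exact f g) :
    (ModuleCat.shortComplexOfCompEqZero f g hfg.linearMap_comp_eq_zero).ShortExact where
  exact := ModuleCat.shortComplex_exact _ hfg
  mono_f := by
    simpa [ModuleCat.mono_iff_injective] using! hf
  epi_g := by
    simpa [ModuleCat.epi_iff_surjective] using! hg

/-- Depth of a cokernel. -/
lemma DepthGE.of_exact_right {t : ℕ} (f : A →ₗ[S N] B) (g : B →ₗ[S N] Q)
    (hf : Function.Injective f) (hg : Function.Surjective g) (hfg : Function.Exact f g)
    (hA : DepthGE (N := N) (t + 1) A) (hB : DepthGE (N := N) t B) : DepthGE (N := N) t Q := by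
  intro L hL hs i hi
  have hex := shortExact_of_linearMap f g hf hg hfg
  have h1 := hB L hL hs i hi
  have h2 := hA L hL hs (i + 1) (by omega)
  refine ⟨fun x y => ?_⟩
  have key : ∀ x : Ext L (ModuleCat.of (S N) Q) i, x = 0 := by
    intro x
    obtain ⟨z, hz⟩ := Ext.covariant_sequence_exact₃ L hex x rfl (h2.elim _ _)
    rw [← hz, h1.elim z 0, Ext.zero_comp]
  rw [key x, key y]

/-- Depth of an extension. -/
lemma DepthGE.of_exact_middle {t : ℕ} (f : A →ₗ[S N] B) (g : B →ₗ[S N] Q)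
    (hf : Function.Injective f) (hg : Function.Surjective g) (hfg : Function.Exact f g)
    (hA : DepthGE (N := N) t A) (hQ : DepthGE (N := N) t Q) : DepthGE (N := N) t B := by
  intro L hL hs i hi
  have hex := shortExact_of_linearMap f g hf hg hfg
  have h1 := hA L hL hs i hi
  have h2 := hQ L hL hs i hi
  have key : ∀ x : Ext L (ModuleCat.of (S N) B) i, x = 0 := by
    intro x
    obtain ⟨z, hz⟩ := Ext.covariant_sequence_exact₂ L hex x (h2.elim _ _)
    rw [← hz, h1.elim z 0, Ext.zero_comp]
  exact ⟨fun x y => by rw [key x, key y]⟩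

lemma DepthGE.of_linearEquiv {t : ℕ} (e : A ≃ₗ[S N] B) (hA : DepthGE (N := N) t A) :
    DepthGE (N := N) t B := by
  intro L hL hs i hi
  have h1 := hA L hL hs i hi
  have key : ∀ x : Ext L (ModuleCat.of (S N) B) i, x = 0 := by
    intro x
    have h2 : (x.comp (Ext.mk₀ e.toModuleIso.inv) (add_zero i)).comp
        (Ext.mk₀ e.toModuleIso.hom) (add_zero i) = x := by
      rw [Ext.comp_assoc_of_third_deg_zero, Ext.mk₀_comp_mk₀, Iso.inv_hom_id, Ext.comp_mk₀_id]
    rw [← h2, h1.elim (x.comp _ _) 0, Ext.zero_comp]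
  exact ⟨fun x y => by rw [key x, key y]⟩

lemma DepthGE.prod {t : ℕ} (hA : DepthGE (N := N) t A) (hB : DepthGE (N := N) t B) :
    DepthGE (N := N) t (A × B) :=
  DepthGE.of_exact_middle (LinearMap.inl _ A B) (LinearMap.snd _ A B) LinearMap.inl_injective
    LinearMap.snd_surjective .inl_snd hA hB

lemma irrel_le_radical_of_eval_ne_zero (I : Ideal (S N))
    (h : ∀ x : Fin N → ℂ, x ≠ 0 → ∃ s ∈ I, eval x s ≠ 0) : irrel N ≤ I.radical := by
  rw [← vanishingIdeal_zeroLocus_eq_radical (K := ℂ), irrel, Ideal.span_le]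
  rintro _ ⟨p, rfl⟩ x hx
  have hx0 : x = 0 := by
    by_contra hne
    obtain ⟨s, hs, hsx⟩ := h x hne
    exact hsx (by simpa [aeval_eq_eval] using hx s hs)
  simp [hx0]

/-- In positive depth, an element annihilated locally away from the origin vanishes. -/
lemma DepthGE.eq_zero (hA : DepthGE (N := N) 1 A) (z : A)
    (hz : ∀ x : Fin N → ℂ, x ≠ 0 → ∃ s : S N, eval x s ≠ 0 ∧ s • z = 0) : z = 0 := by
  set I : Ideal (S N) := Ideal.torsionOf (S N) A z
  have hrad : irrel N ≤ I.radical := irrel_le_radical_of_eval_ne_zero I fun x hx => by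
    obtain ⟨s, h1, h2⟩ := hz x hx
    exact ⟨s, (Ideal.mem_torsionOf_iff _ _).2 h2, h1⟩
  have hsub := hA (ModuleCat.of (S N) (S N ⧸ I))
    (inferInstanceAs (Module.Finite (S N) (S N ⧸ I)))
    (by
      change Module.support (S N) (S N ⧸ I) ⊆ _
      rw [Module.support_eq_zeroLocus, Ideal.annihilator_quotient,
        PrimeSpectrum.zeroLocus_subset_zeroLocus_iff]
      exact hrad) 0 one_pos
  have h1 := (Ext.addEquiv₀.subsingleton_congr).mp hsub
  have : Subsingleton ((S N ⧸ I) →ₗ[S N] A) := (ModuleCat.homAddEquiv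
    (M := ModuleCat.of (S N) (S N ⧸ I)) (N := ModuleCat.of (S N) A)).symm.subsingleton
  have h2 := LinearMap.congr_fun (this.elim (Submodule.liftQ I (LinearMap.toSpanSingleton (S N) A z)
    (fun s hs => by simpa using! (Ideal.mem_torsionOf_iff _ _).1 hs)) 0) (Submodule.Quotient.mk 1)
  simpa only [Submodule.liftQ_apply, LinearMap.toSpanSingleton_apply, one_smul,
    LinearMap.zero_apply] using h2

lemma depthGE_one_of_forall
    (h : ∀ z : A, irrel N ≤ (Ideal.torsionOf (S N) A z).radical → z = 0) :
    DepthGE (N := N) 1 A := by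
  intro L hL hs i hi
  obtain rfl : i = 0 := by omega
  rw [Module.support_eq_zeroLocus, PrimeSpectrum.zeroLocus_subset_zeroLocus_iff] at hs
  refine (Ext.addEquiv₀.subsingleton_congr).mpr ?_
  have : Subsingleton (L →ₗ[S N] A) := by
    refine ⟨fun u v => ?_⟩
    have key : ∀ u : L →ₗ[S N] A, u = 0 := fun u => LinearMap.ext fun y => h _ <| hs.trans <|
      Ideal.radical_mono fun s hs => (Ideal.mem_torsionOf_iff _ _).2 (by
        rw [← map_smul, Module.mem_annihilator.1 hs y, map_zero])
    rw [key u, key v]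
  exact ModuleCat.homAddEquiv.subsingleton

lemma DepthGE.pi_one (ι : Type) (hA : DepthGE (N := N) 1 A) : DepthGE (N := N) 1 (ι → A) := by
  refine depthGE_one_of_forall fun z hz => funext fun i => hA.eq_zero _ fun x hx => ?_
  obtain ⟨p, hp⟩ := Function.ne_iff.1 hx
  obtain ⟨k, hk⟩ := hz (Ideal.subset_span ⟨p, rfl⟩)
  refine ⟨X p ^ k, by simpa using fun h => absurd h hp, ?_⟩
  exact congrFun ((Ideal.mem_torsionOf_iff _ _).1 hk) i

lemma isRegular_X_list {N : ℕ} (l : List (Fin N)) (hl : l.Nodup) :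
    RingTheory.Sequence.IsRegular (S N) (l.map (X : Fin N → S N)) := by
  have hof : ∀ l : List (Fin N), Ideal.ofList (l.map (X : Fin N → S N)) =
      Ideal.span (X '' {i | i ∈ l}) := by
    intro l
    rw [Ideal.ofList]
    congr 1
    ext; simp
  refine ⟨⟨fun i hi => ?_⟩, ?_⟩
  · simp only [List.length_map] at hi
    rw [← List.map_take, hof, List.getElem_map]
    have hnot : l[i] ∉ l.take i := by
      intro h
      obtain ⟨k, hk, he⟩ := List.mem_take_iff_getElem.1 h
      have := (List.Nodup.getElem_inj_iff hl).1 he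
      omega
    rw [isSMulRegular_iff_right_eq_zero_of_smul]
    intro z hz
    obtain ⟨p, rfl⟩ := Submodule.Quotient.mk_surjective _ z
    rw [← Submodule.Quotient.mk_smul] at hz
    rw [Submodule.Quotient.mk_eq_zero] at hz ⊢
    simp only [smul_eq_mul, Ideal.mul_top] at hz ⊢
    rw [mem_ideal_span_X_image] at hz ⊢
    intro m hm
    obtain ⟨k, hk, hk'⟩ := hz (m + Finsupp.single l[i] 1) (by
      rw [mem_support_iff] at hm ⊢
      rwa [mul_comm, coeff_mul_X])
    refine ⟨k, hk, ?_⟩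
    have : l[i] ≠ k := fun h => hnot (h ▸ hk)
    simpa [Finsupp.single_apply, this] using hk'
  · rw [hof]
    simp only [smul_eq_mul, Ideal.mul_top]
    intro h
    have h1 : (1 : S N) ∈ Ideal.span (X '' {i | i ∈ l}) := h ▸ Submodule.mem_top
    rw [mem_ideal_span_X_image] at h1
    simpa using h1 0 (by simp)

lemma depthGE_self (N : ℕ) : DepthGE (N := N) N (S N) := by
  intro L hL hs i hi
  refine ModuleCat.subsingleton_ext_of_exists_isRegular (irrel N) L hs (ModuleCat.of (S N) (S N))
    ?_ ((List.finRange N).map X) ?_ (isRegular_X_list _ (List.nodup_finRange N)) i (by simpa)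
  · have := (isRegular_X_list (List.finRange N) (List.nodup_finRange N)).top_ne_smul
    rw [lt_top_iff_ne_top, ne_comm]
    convert this using 2
    rw [irrel, Ideal.ofList]
    congr 2
    ext; simp
  · simp only [List.mem_map]
    rintro _ ⟨p, -, rfl⟩
    exact Ideal.subset_span ⟨p, rfl⟩

end Depth

section Regular

/-- The derivation `∑ᵢ vᵢ ∂ᵢ` attached to a polynomial vector field. -/
noncomputable def vecDeriv {N : ℕ} (v : Fin N → S N) : Derivation ℂ (S N) (S N) :=
  ∑ c, v c • pderiv c

lemma vecDeriv_apply {N : ℕ} (v : Fin N → S N) (p : S N) :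
    vecDeriv v p = ∑ c, v c * pderiv c p := by
  have h := map_sum (Derivation.coeFnAddMonoidHom (R := ℂ) (A := S N) (M := S N))
    (fun c => v c • pderiv c) univ
  have hp := congrFun h p
  rw [Finset.sum_apply] at hp
  exact hp

/-- Cramer's rule: if the differentials of the `Fᵢ`, `i ∈ U`, are independent at `x`, there is a
polynomial vector field killing all of them but `F_l`, whose value on `F_l` is nonzero at `x`. -/
lemma exists_vecDeriv {N : ℕ} {ι : Type} [DecidableEq ι] (F : ι → S N) (U : Finset ι)
    (x : Fin N → ℂ)
    (hU : LinearIndependent ℂ (fun i : U => (fun k => eval x (pderiv k (F i)) : Fin N → ℂ)))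
    {l : ι} (hl : l ∈ U) :
    ∃ v : Fin N → S N, (∀ i ∈ U, i ≠ l → vecDeriv v (F i) = 0) ∧
      eval x (vecDeriv v (F l)) ≠ 0 := by
  set u : U → Fin N → ℂ := fun i k => eval x (pderiv k (F i)) with hu
  obtain ⟨φ, hφ⟩ := LinearMap.exists_leftInverse_of_injective (Fintype.linearCombination ℂ u)
    (LinearMap.ker_eq_bot.2 hU.fintypeLinearCombination_injective)
  have hφu : ∀ i, φ (u i) = Pi.single i 1 := by
    intro i
    have := LinearMap.congr_fun hφ (Pi.single i 1)
    simpa [Fintype.linearCombination_apply_single] using this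
  set M : Matrix U U (S N) :=
    Matrix.of fun i j => ∑ c, pderiv c (F i) * C (φ (Pi.single c 1) j) with hM
  have hMx : M.map (eval x) = 1 := by
    ext i j
    have h1 : u i = ∑ c, u i c • (Pi.single c 1 : Fin N → ℂ) := by
      ext k; simp [Finset.sum_apply, Pi.single_apply]
    have h2 := congrFun (hφu i) j
    rw [h1, map_sum, Finset.sum_apply] at h2
    simp only [map_smul, Pi.smul_apply, smul_eq_mul] at h2
    simp only [hM, Matrix.map_apply, Matrix.of_apply, map_sum, map_mul, eval_C, Matrix.one_apply]
    exact h2.trans (by simp [Pi.single_apply, eq_comm])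
  have hdet : eval x M.det = 1 := by
    rw [RingHom.map_det, RingHom.mapMatrix_apply, hMx, Matrix.det_one]
  have key : ∀ i : U, vecDeriv (fun c => ∑ j, C (φ (Pi.single c 1) j) * M.adjugate j ⟨l, hl⟩) (F i)
      = if i = ⟨l, hl⟩ then M.det else 0 := by
    intro i
    have h1 := congrFun (congrFun (Matrix.mul_adjugate M) i) ⟨l, hl⟩
    rw [Matrix.mul_apply, Matrix.smul_apply, Matrix.one_apply, smul_eq_mul, mul_ite, mul_one,
      mul_zero] at h1
    rw [vecDeriv_apply, ← h1]
    simp only [hM, Matrix.of_apply, Finset.sum_mul]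
    rw [Finset.sum_comm]
    refine Finset.sum_congr rfl fun c _ => Finset.sum_congr rfl fun j _ => by ring
  refine ⟨fun c => ∑ j, C (φ (Pi.single c 1) j) * M.adjugate j ⟨l, hl⟩, fun i hi hil => ?_, ?_⟩
  · rw [key ⟨i, hi⟩, if_neg (by simpa using hil)]
  · rw [key ⟨l, hl⟩, if_pos rfl, hdet]
    exact one_ne_zero

/-- If a derivation preserves `J`, then elements which are `k`-power torsion modulo `J` are
also torsion for the derivative of `k`. -/
lemma exists_pow_mul_mem_of_derivation {N : ℕ} (J : Ideal (S N)) (v : Derivation ℂ (S N) (S N))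
    (hv : ∀ p ∈ J, v p ∈ J) (k h : S N) (hk : k * h ∈ J) : ∃ e : ℕ, v k ^ e * h ∈ J := by
  let chain : ℕ →o Ideal (S N) :=
    { toFun := fun i => Submodule.comap (LinearMap.mulLeft (S N) (k ^ i)) J
      monotone' := monotone_nat_of_le_succ fun i p hp => by
        simp only [Submodule.mem_comap, LinearMap.mulLeft_apply] at hp ⊢
        rw [pow_succ', mul_assoc]
        exact J.mul_mem_left _ hp }
  obtain ⟨r, hr⟩ := monotone_stabilizes_iff_noetherian.2 (inferInstance : IsNoetherian (S N) (S N))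
    chain
  have hstab : ∀ p, k ^ (r + 1) * p ∈ J → k ^ r * p ∈ J := by
    intro p hp
    have : p ∈ chain (r + 1) := hp
    rw [← hr (r + 1) (by omega)] at this
    exact this
  have hder : ∀ p, k ^ r * p ∈ J → k ^ r * v p ∈ J := by
    intro p hp
    apply hstab
    have h1 : k ^ (r + 1) * p ∈ J := by
      rw [pow_succ', mul_assoc]; exact J.mul_mem_left _ hp
    have h2 := hv _ h1
    rw [Derivation.leibniz, Derivation.leibniz_pow] at h2
    have h3 : p * ((r + 1) * k ^ r * v k) ∈ J := by
      have := J.mul_mem_left ((r + 1) * v k) hp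
      convert this using 1; ring
    have h4 := J.sub_mem h2 h3
    convert h4 using 1
    simp only [smul_eq_mul, nsmul_eq_mul, Nat.add_sub_cancel, Nat.cast_add, Nat.cast_one]
    ring
  have main : ∀ a b, a + b = r → ∀ p, k ^ r * p ∈ J → k ^ a * (v k ^ (2 * b) * p) ∈ J := by
    intro a b
    induction b generalizing a with
    | zero => rintro rfl p hp; simpa using hp
    | succ b ih =>
      intro hab p hp
      have ih' := ih (a + 1) (by omega)
      have h1 := J.mul_mem_left (v k) (hv _ (ih' p hp))
      have h2 := J.mul_mem_left (v k) (ih' _ (hder p hp))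
      have h3 := J.mul_mem_left (2 * b * v (v k)) (ih' p hp)
      have h4 : v k * (v k ^ (2 * b - 1) * (2 * b)) = 2 * b * v k ^ (2 * b) := by
        cases b with
        | zero => simp
        | succ b => rw [show 2 * (b + 1) - 1 = 2 * b + 1 by omega]; push_cast; ring
      have h5 : ((a : S N) + 1) * (k ^ a * (v k ^ (2 * (b + 1)) * p)) ∈ J := by
        have := J.sub_mem (J.sub_mem h1 h2) h3
        convert this using 1
        rw [Derivation.leibniz, Derivation.leibniz, Derivation.leibniz_pow, Derivation.leibniz_pow]
        simp only [smul_eq_mul, nsmul_eq_mul, Nat.add_sub_cancel, Nat.cast_add, Nat.cast_one,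
          Nat.cast_mul, Nat.cast_ofNat]
        linear_combination (-k ^ (a + 1) * p * v (v k)) * h4
      have h6 := J.mul_mem_left (C ((a : ℂ) + 1)⁻¹) h5
      have h7 : C ((a : ℂ) + 1)⁻¹ * ((a : S N) + 1) = 1 := by
        rw [show ((a : S N) + 1) = C ((a : ℂ) + 1) by simp, ← C_mul,
          inv_mul_cancel₀ (Nat.cast_add_one_ne_zero a), C_1]
      rwa [← mul_assoc, h7, one_mul] at h6
  have hkr : k ^ r * h ∈ J := by
    apply hstab
    rw [pow_succ, mul_assoc]
    exact J.mul_mem_left _ hk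
  exact ⟨2 * r, by simpa using main 0 r (by omega) h hkr⟩

/-- The differentials of the `Fᵢ` vanishing at a nonzero point are independent there. -/
def SNC {N : ℕ} {ι : Type} (F : ι → S N) : Prop :=
  ∀ x : Fin N → ℂ, x ≠ 0 → ∀ U : Finset ι, (∀ i ∈ U, eval x (F i) = 0) →
    LinearIndependent ℂ (fun i : U => (fun k => eval x (pderiv k (F i)) : Fin N → ℂ))

/-- The ideal generated by the `Fᵢ` with `i ∈ T`. -/
noncomputable def idealOf {N : ℕ} {ι : Type} (F : ι → S N) (T : Finset ι) : Ideal (S N) :=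
  Ideal.span (F '' T)

variable {N : ℕ} {ι : Type} {F : ι → S N}

lemma mem_idealOf {T : Finset ι} {i : ι} (hi : i ∈ T) : F i ∈ idealOf F T :=
  Ideal.subset_span ⟨i, hi, rfl⟩

/-- Membership in `idealOf F T` may be tested locally away from the origin. -/
lemma mem_idealOf_of_local {T : Finset ι} (hT : DepthGE (N := N) 1 (S N ⧸ idealOf F T)) (h : S N)
    (hloc : ∀ x : Fin N → ℂ, x ≠ 0 → (∀ i ∈ T, eval x (F i) = 0) →
      ∃ s, eval x s ≠ 0 ∧ s * h ∈ idealOf F T) : h ∈ idealOf F T := by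
  rw [← Submodule.Quotient.mk_eq_zero]
  refine hT.eq_zero _ fun x hx => ?_
  simp_rw [← Submodule.Quotient.mk_smul, Submodule.Quotient.mk_eq_zero, smul_eq_mul]
  by_cases hz : ∀ i ∈ T, eval x (F i) = 0
  · exact hloc x hx hz
  · push Not at hz
    obtain ⟨i, hi, hne⟩ := hz
    exact ⟨F i, hne, Ideal.mul_mem_right _ _ (mem_idealOf hi)⟩

lemma vecDeriv_mem_idealOf {T : Finset ι} {v : Fin N → S N}
    (hv : ∀ i ∈ T, vecDeriv v (F i) = 0) (p : S N) (hp : p ∈ idealOf F T) :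
    vecDeriv v p ∈ idealOf F T := by
  induction hp using Submodule.span_induction with
  | mem p hp =>
    obtain ⟨i, hi, rfl⟩ := hp
    rw [hv i hi]; exact zero_mem _
  | zero => rw [map_zero]; exact zero_mem _
  | add p q _ _ hp hq => rw [map_add]; exact add_mem hp hq
  | smul s p hp ih =>
    rw [smul_eq_mul, Derivation.leibniz]
    exact add_mem (Ideal.mul_mem_left _ _ ih) (Ideal.mul_mem_right _ _ hp)

variable [DecidableEq ι]

lemma SNC.regular (hF : SNC F) {T : Finset ι} (hT : DepthGE (N := N) 1 (S N ⧸ idealOf F T))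
    {l : ι} (hl : l ∉ T) (h : S N) (hh : F l * h ∈ idealOf F T) : h ∈ idealOf F T := by
  refine mem_idealOf_of_local hT h fun x hx hxT => ?_
  by_cases hxl : eval x (F l) = 0
  · obtain ⟨v, hv, hvl⟩ := exists_vecDeriv F (insert l T) x
      (hF x hx _ (by simpa [hxl] using hxT)) (mem_insert_self l T)
    obtain ⟨e, he⟩ := exists_pow_mul_mem_of_derivation (idealOf F T) (vecDeriv v)
      (vecDeriv_mem_idealOf fun i hi => hv i (mem_insert_of_mem hi)
        (fun h => hl (h ▸ hi))) (F l) h hh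
    exact ⟨_, by rw [map_pow]; exact pow_ne_zero e hvl, he⟩
  · exact ⟨F l, hxl, hh⟩

lemma SNC.depthGE (hF : SNC F) (T : Finset ι) :
    ∀ t, t + T.card ≤ N → DepthGE (N := N) t (S N ⧸ idealOf F T) := by
  induction T using Finset.induction_on with
  | empty =>
    intro t ht
    refine ((depthGE_self N).mono (by simpa using ht)).of_linearEquiv ?_
    exact (Submodule.quotEquivOfEqBot _ (by simp [idealOf])).symm
  | insert l T hl ih =>
    intro t ht
    rw [card_insert_of_notMem hl] at ht
    have hT1 := ih (t + 1) (by omega)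
    have hle : idealOf F T ≤ idealOf F (insert l T) :=
      Ideal.span_mono (Set.image_mono (by simp))
    refine DepthGE.of_exact_right (A := S N ⧸ idealOf F T) (B := S N ⧸ idealOf F T)
      (LinearMap.lsmul (S N) _ (F l)) (Submodule.factor hle) ?_ (Submodule.factor_surjective hle)
      ?_ hT1 (hT1.mono (by omega))
    · rw [← LinearMap.ker_eq_bot, LinearMap.ker_eq_bot']
      intro z hz
      obtain ⟨p, rfl⟩ := Submodule.Quotient.mk_surjective _ z
      rw [LinearMap.lsmul_apply, ← Submodule.Quotient.mk_smul, Submodule.Quotient.mk_eq_zero] at hz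
      rw [Submodule.Quotient.mk_eq_zero]
      exact hF.regular (hT1.mono (by omega)) hl p hz
    · intro z
      obtain ⟨p, rfl⟩ := Submodule.Quotient.mk_surjective _ z
      rw [show Submodule.factor hle (Submodule.Quotient.mk p) = Submodule.Quotient.mk p from rfl,
        Submodule.Quotient.mk_eq_zero]
      constructor
      · intro hp
        rw [idealOf, coe_insert, Set.image_insert_eq, Ideal.mem_span_insert] at hp
        obtain ⟨a, q, hq, rfl⟩ := hp
        refine ⟨Submodule.Quotient.mk a, ?_⟩
        rw [LinearMap.lsmul_apply, ← Submodule.Quotient.mk_smul, Submodule.Quotient.eq]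
        have : F l • a - (a * F l + q) = -q := by rw [smul_eq_mul]; ring
        rw [this]
        exact neg_mem hq
      · rintro ⟨w, hw⟩
        obtain ⟨a, rfl⟩ := Submodule.Quotient.mk_surjective _ w
        rw [LinearMap.lsmul_apply, ← Submodule.Quotient.mk_smul, Submodule.Quotient.eq] at hw
        have h1 : F l • a ∈ idealOf F (insert l T) :=
          Ideal.mul_mem_right _ _ (mem_idealOf (mem_insert_self l T))
        have := sub_mem h1 (hle hw)
        rwa [sub_sub_cancel] at this

end Regular

section Division

variable {N : ℕ} {ι : Type} [DecidableEq ι] {F : ι → S N}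

lemma mem_idealOf_insert {T : Finset ι} {l : ι} {p : S N} :
    p ∈ idealOf F (insert l T) ↔ ∃ a, p - a * F l ∈ idealOf F T := by
  rw [idealOf, coe_insert, Set.image_insert_eq, Ideal.mem_span_insert]
  constructor
  · rintro ⟨a, q, hq, rfl⟩
    exact ⟨a, by simpa [idealOf] using hq⟩
  · rintro ⟨a, ha⟩
    exact ⟨a, _, ha, by ring⟩

lemma idealOf_le_insert {T : Finset ι} {l : ι} : idealOf F T ≤ idealOf F (insert l T) :=
  Ideal.span_mono (Set.image_mono (by simp))

lemma SNC.regular_prod (hF : SNC F) {T : Finset ι} (hT : T.card + 1 ≤ N) {K : Finset ι}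
    (hK : Disjoint K T) (h : S N) (hh : (∏ l ∈ K, F l) * h ∈ idealOf F T) : h ∈ idealOf F T := by
  induction K using Finset.induction_on with
  | empty => simpa using hh
  | insert l K hl ih =>
    rw [disjoint_insert_left] at hK
    rw [prod_insert hl, mul_assoc] at hh
    exact ih hK.2 (hF.regular (hF.depthGE T 1 (by omega)) hK.1 _ hh)

/-- An element lying in every `(F_T, F_k)`, `k ∈ K`, lies in `(F_T, ∏ F_k)`. -/
lemma SNC.mem_of_forall_mem_insert (hF : SNC F) {T : Finset ι} (hT : T.card + 2 ≤ N)
    {K : Finset ι} (hK : Disjoint K T) (b : S N)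
    (hb : ∀ k ∈ K, b ∈ idealOf F (insert k T)) :
    ∃ b', b - b' * ∏ k ∈ K, F k ∈ idealOf F T := by
  induction K using Finset.induction_on with
  | empty => exact ⟨b, by simp⟩
  | insert k K hk ih =>
    rw [disjoint_insert_left] at hK
    obtain ⟨b', hb'⟩ := ih hK.2 fun l hl => hb l (mem_insert_of_mem hl)
    have h1 : (∏ l ∈ K, F l) * b' ∈ idealOf F (insert k T) := by
      have := sub_mem (hb k (mem_insert_self k K)) (idealOf_le_insert hb')
      rwa [sub_sub_cancel, mul_comm] at this
    have h2 := hF.regular_prod (T := insert k T) (by rw [card_insert_of_notMem hK.1]; omega)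
      (disjoint_insert_right.2 ⟨hk, hK.2⟩) b' h1
    obtain ⟨a, ha⟩ := mem_idealOf_insert.1 h2
    refine ⟨a, ?_⟩
    rw [prod_insert hk]
    convert add_mem hb' (Ideal.mul_mem_left _ (∏ l ∈ K, F l) ha) using 1
    ring

/-- Coefficients of `α ∧ β ∧ γ`. -/
noncomputable def wedge3 (α β γ : Fin N → S N) (p q r : Fin N) : S N :=
  α p * (β q * γ r - β r * γ q) - α q * (β p * γ r - β r * γ p) + α r * (β p * γ q - β q * γ p)

lemma sum_mul_sum_mul_wedge3 (α β γ u v : Fin N → S N) (r : Fin N)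
    (hv : ∑ q, v q * α q = 0) (hu : ∑ p, u p * β p = 0) :
    ∑ p, ∑ q, u p * v q * wedge3 α β γ p q r =
      (∑ p, u p * α p) * (∑ q, v q * β q) * γ r
      - (∑ q, v q * β q) * (∑ p, u p * γ p) * α r
      - (∑ p, u p * α p) * (∑ q, v q * γ q) * β r := by
  have h : ∀ p q, u p * v q * wedge3 α β γ p q r =
      (u p * α p) * (v q * β q) * γ r - (u p * α p) * (v q * γ q) * β r
      - (u p * β p) * (v q * α q) * γ r + (u p * γ p) * (v q * α q) * β r
      + (u p * β p) * (v q * γ q) * α r - (u p * γ p) * (v q * β q) * α r := by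
    intro p q; rw [wedge3]; ring
  simp_rw [h, sum_sub_distrib, sum_add_distrib, sum_sub_distrib, ← sum_mul, ← mul_sum, ← sum_mul,
    hv, hu]
  ring

/-- If `b` annihilates `dF_i ∧ dF_j ∧ dF_k` modulo `(F_i, F_j, F_k)`, it lies in that ideal. -/
lemma SNC.mem_of_mul_wedge3_mem (hF : SNC F) {i j k : ι} (hij : i ≠ j) (hik : i ≠ k) (hjk : j ≠ k)
    (hN : 4 ≤ N) (b : S N)
    (hb : ∀ p q r, b * wedge3 (fun c => pderiv c (F i)) (fun c => pderiv c (F j))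
      (fun c => pderiv c (F k)) p q r ∈ idealOf F {i, j, k}) : b ∈ idealOf F {i, j, k} := by
  refine mem_idealOf_of_local (hF.depthGE _ 1 (by
    have := card_le_three (a := i) (b := j) (c := k); omega)) b fun x hx hxT => ?_
  have hlin := hF x hx _ hxT
  obtain ⟨u, hu, hu'⟩ := exists_vecDeriv F _ x hlin (l := i) (by simp)
  obtain ⟨v, hv, hv'⟩ := exists_vecDeriv F _ x hlin (l := j) (by simp)
  obtain ⟨w, hw, hw'⟩ := exists_vecDeriv F _ x hlin (l := k) (by simp)
  refine ⟨vecDeriv u (F i) * vecDeriv v (F j) * vecDeriv w (F k), ?_, ?_⟩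
  · simp only [map_mul]
    exact mul_ne_zero (mul_ne_zero hu' hv') hw'
  have e1 := hw i (by simp) hik
  have e2 := hw j (by simp) hjk
  have h1 := hv i (by simp) hij
  have h2 := hu j (by simp) hij.symm
  simp only [vecDeriv_apply] at h1 h2 e1 e2 ⊢
  have h3 : ∀ r, _ := fun r => sum_mul_sum_mul_wedge3 (fun c => pderiv c (F i))
    (fun c => pderiv c (F j)) (fun c => pderiv c (F k)) u v r h1 h2
  have h4 : (∑ p, u p * pderiv p (F i)) * (∑ q, v q * pderiv q (F j)) *
      (∑ r, w r * pderiv r (F k)) * b =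
      ∑ r, ∑ p, ∑ q, (w r * (u p * v q)) * (b * wedge3 (fun c => pderiv c (F i))
        (fun c => pderiv c (F j)) (fun c => pderiv c (F k)) p q r) := by
    have h5 : ∀ r, ∑ p, ∑ q, (w r * (u p * v q)) * (b * wedge3 (fun c => pderiv c (F i))
        (fun c => pderiv c (F j)) (fun c => pderiv c (F k)) p q r) =
        b * (∑ p, u p * pderiv p (F i)) * (∑ q, v q * pderiv q (F j)) * (w r * pderiv r (F k))
        - b * (∑ q, v q * pderiv q (F j)) * (∑ p, u p * pderiv p (F k)) * (w r * pderiv r (F i))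
        - b * (∑ p, u p * pderiv p (F i)) * (∑ q, v q * pderiv q (F k)) *
          (w r * pderiv r (F j)) := by
      intro r
      have h6 : ∑ p, ∑ q, (w r * (u p * v q)) * (b * wedge3 (fun c => pderiv c (F i))
          (fun c => pderiv c (F j)) (fun c => pderiv c (F k)) p q r) =
          w r * b * ∑ p, ∑ q, u p * v q * wedge3 (fun c => pderiv c (F i))
            (fun c => pderiv c (F j)) (fun c => pderiv c (F k)) p q r := by
        rw [mul_sum]
        refine sum_congr rfl fun p _ => ?_
        rw [mul_sum]
        exact sum_congr rfl fun q _ => by ring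
      rw [h6, h3 r]
      ring
    simp_rw [h5, sum_sub_distrib, ← mul_sum, e1, e2]
    ring
  rw [h4]
  exact sum_mem fun r _ => sum_mem fun p _ => sum_mem fun q _ => Ideal.mul_mem_left _ _ (hb p q r)

/-- Division: a form `γ` with `dF_i ∧ dF_j ∧ γ = 0` modulo `(F_i, F_j)` is, modulo that ideal,
a combination of `dF_i` and `dF_j`. -/
lemma SNC.division (hF : SNC F) {i j : ι} (hij : i ≠ j) (hN : 4 ≤ N) (γ : Fin N → S N)
    (hγ : ∀ p q r, wedge3 (fun c => pderiv c (F i)) (fun c => pderiv c (F j)) γ p q r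
      ∈ idealOf F {i, j}) :
    ∃ a b, ∀ p, γ p - (a * pderiv p (F i) + b * pderiv p (F j)) ∈ idealOf F {i, j} := by
  set J := idealOf F {i, j} with hJ
  have hdep : DepthGE (N := N) 2 (S N ⧸ J) := hF.depthGE _ 2 (by
    have := card_le_two (a := i) (b := j); omega)
  have hdep1 := hdep.mono one_le_two
  let φ : ((S N ⧸ J) × (S N ⧸ J)) →ₗ[S N] (Fin N → S N ⧸ J) := LinearMap.pi fun p =>
    (pderiv p (F i)) • LinearMap.fst _ _ _ + (pderiv p (F j)) • LinearMap.snd _ _ _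
  have hφ : ∀ a b p, φ (Submodule.Quotient.mk a, Submodule.Quotient.mk b) p =
      Submodule.Quotient.mk (a * pderiv p (F i) + b * pderiv p (F j)) := by
    intro a b p
    rw [mul_comm a, mul_comm b, Submodule.Quotient.mk_add, ← smul_eq_mul, ← smul_eq_mul,
      Submodule.Quotient.mk_smul, Submodule.Quotient.mk_smul]
    rfl
  have hinj : Function.Injective φ := by
    rw [← LinearMap.ker_eq_bot, LinearMap.ker_eq_bot']
    rintro ⟨a, b⟩ hab
    obtain ⟨a, rfl⟩ := Submodule.Quotient.mk_surjective _ a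
    obtain ⟨b, rfl⟩ := Submodule.Quotient.mk_surjective _ b
    have h0 : ∀ p, a * pderiv p (F i) + b * pderiv p (F j) ∈ J := fun p => by
      rw [← Submodule.Quotient.mk_eq_zero, ← hφ, hab]; rfl
    have h1 : ∀ v : Fin N → S N, a * vecDeriv v (F i) + b * vecDeriv v (F j) ∈ J := fun v => by
      rw [vecDeriv_apply, vecDeriv_apply, mul_sum, mul_sum, ← sum_add_distrib]
      refine sum_mem fun p _ => ?_
      convert Ideal.mul_mem_left _ (v p) (h0 p) using 1
      ring
    refine Prod.ext ((Submodule.Quotient.mk_eq_zero _).2 ?_)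
      ((Submodule.Quotient.mk_eq_zero _).2 ?_)
    · refine mem_idealOf_of_local hdep1 a fun x hx hxT => ?_
      obtain ⟨v, hv, hv'⟩ := exists_vecDeriv F _ x (hF x hx _ hxT) (l := i) (by simp)
      have := h1 v
      rw [hv j (by simp) hij.symm, mul_zero, add_zero, mul_comm] at this
      exact ⟨_, hv', this⟩
    · refine mem_idealOf_of_local hdep1 b fun x hx hxT => ?_
      obtain ⟨v, hv, hv'⟩ := exists_vecDeriv F _ x (hF x hx _ hxT) (l := j) (by simp)
      have := h1 v
      rw [hv i (by simp) hij, mul_zero, zero_add, mul_comm] at this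
      exact ⟨_, hv', this⟩
  have hQ : DepthGE (N := N) 1 ((Fin N → S N ⧸ J) ⧸ LinearMap.range φ) :=
    DepthGE.of_exact_right φ (LinearMap.range φ).mkQ hinj (Submodule.mkQ_surjective _)
      (LinearMap.exact_map_mkQ_range φ) (hdep.prod hdep) (hdep1.pi_one _)
  have hloc : ∀ x : Fin N → ℂ, x ≠ 0 → ∃ s, eval x s ≠ 0 ∧
      ∃ a b, ∀ p, s * γ p - (a * pderiv p (F i) + b * pderiv p (F j)) ∈ J := by
    intro x hx
    by_cases hz : ∀ l ∈ ({i, j} : Finset ι), eval x (F l) = 0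
    · obtain ⟨u, hu, hu'⟩ := exists_vecDeriv F _ x (hF x hx _ hz) (l := i) (by simp)
      obtain ⟨v, hv, hv'⟩ := exists_vecDeriv F _ x (hF x hx _ hz) (l := j) (by simp)
      refine ⟨vecDeriv u (F i) * vecDeriv v (F j), by
        rw [map_mul]; exact mul_ne_zero hu' hv', vecDeriv v (F j) * (∑ p, u p * γ p),
        vecDeriv u (F i) * (∑ q, v q * γ q), fun r => ?_⟩
      have h1 := hv i (by simp) hij
      have h2 := hu j (by simp) hij.symm
      simp only [vecDeriv_apply] at h1 h2 ⊢
      have h3 := sum_mul_sum_mul_wedge3 (fun c => pderiv c (F i))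
        (fun c => pderiv c (F j)) γ u v r h1 h2
      rw [← sub_sub, ← h3]
      exact sum_mem fun p _ => sum_mem fun q _ => Ideal.mul_mem_left _ _ (hγ p q r)
    · push Not at hz
      obtain ⟨l, hl, hne⟩ := hz
      exact ⟨F l, hne, 0, 0, fun p => by
        simpa using Ideal.mul_mem_right (γ p) J (mem_idealOf hl)⟩
  have hmem : (fun p => Submodule.Quotient.mk (γ p) : Fin N → S N ⧸ J) ∈ LinearMap.range φ := by
    rw [← Submodule.Quotient.mk_eq_zero]
    refine hQ.eq_zero _ fun x hx => ?_
    obtain ⟨s, hs, a, b, hab⟩ := hloc x hx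
    refine ⟨s, hs, ?_⟩
    rw [← Submodule.Quotient.mk_smul, Submodule.Quotient.mk_eq_zero]
    refine ⟨(Submodule.Quotient.mk a, Submodule.Quotient.mk b), funext fun p => ?_⟩
    rw [hφ, Pi.smul_apply, ← Submodule.Quotient.mk_smul, eq_comm, Submodule.Quotient.eq]
    exact hab p
  obtain ⟨⟨a, b⟩, hab⟩ := hmem
  obtain ⟨a, rfl⟩ := Submodule.Quotient.mk_surjective _ a
  obtain ⟨b, rfl⟩ := Submodule.Quotient.mk_surjective _ b
  refine ⟨a, b, fun p => ?_⟩
  have := congrFun hab p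
  rw [hφ, eq_comm, Submodule.Quotient.eq] at this
  exact this

end Division

section Grading

variable {N : ℕ}

/-- Homogeneity of integer degree; in negative degree only `0` is homogeneous. -/
abbrev HomogZ (z : ℤ) (p : S N) : Prop := IsWeightedHomogeneous (fun _ => (1 : ℤ)) p z

lemma weight_one_int (u : Fin N →₀ ℕ) :
    Finsupp.weight (fun _ => (1 : ℤ)) u = (Finsupp.weight (1 : Fin N → ℕ) u : ℕ) := by
  simp [Finsupp.weight_apply, Finsupp.sum]

lemma homogZ_natCast {n : ℕ} {p : S N} : HomogZ (n : ℤ) p ↔ p.IsHomogeneous n := by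
  refine forall₂_congr fun u _ => ?_
  rw [weight_one_int, Nat.cast_inj]

lemma HomogZ.eq_zero {z : ℤ} {p : S N} (hp : HomogZ z p) (hz : z < 0) : p = 0 := by
  ext u
  by_contra h
  have := hp h
  rw [weight_one_int] at this
  omega

lemma HomogZ.pderiv {z : ℤ} {p : S N} (hp : HomogZ z p) (k : Fin N) :
    HomogZ (z - 1) (pderiv k p) :=
  IsWeightedHomogeneous.pderiv hp (by ring)

lemma HomogZ.congr {z z' : ℤ} {p : S N} (hp : HomogZ z p) (h : z = z') : HomogZ z' p := h ▸ hp

/-- The homogeneous component of integer degree. -/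
noncomputable abbrev compZ (z : ℤ) : S N →ₗ[ℂ] S N :=
  weightedHomogeneousComponent (fun _ => (1 : ℤ)) z

lemma homogZ_compZ (z : ℤ) (p : S N) : HomogZ z (compZ z p) :=
  weightedHomogeneousComponent_isWeightedHomogeneous _ _

lemma compZ_mul {z k : ℤ} {q : S N} (hq : HomogZ k q) (p : S N) :
    compZ z (p * q) = compZ (z - k) p * q := by
  induction p using MvPolynomial.induction_on' with
  | add p₁ p₂ h₁ h₂ => rw [add_mul, map_add, map_add, h₁, h₂, add_mul]
  | monomial u a =>
    have hu := isWeightedHomogeneous_monomial (fun _ => (1 : ℤ)) u a rfl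
    by_cases h : Finsupp.weight (fun _ => (1 : ℤ)) u + k = z
    · have h' : Finsupp.weight (fun _ => (1 : ℤ)) u = z - k := by omega
      rw [← h, compZ, (hu.mul hq).weightedHomogeneousComponent_same, h, ← h',
        hu.weightedHomogeneousComponent_same]
    · have h' : Finsupp.weight (fun _ => (1 : ℤ)) u ≠ z - k := by omega
      rw [compZ, (hu.mul hq).weightedHomogeneousComponent_ne _ (Ne.symm h),
        hu.weightedHomogeneousComponent_ne _ h'.symm, zero_mul]

lemma compZ_self {z : ℤ} {p : S N} (hp : HomogZ z p) : compZ z p = p :=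
  hp.weightedHomogeneousComponent_same

lemma compZ_neg {z : ℤ} (hz : z < 0) (p : S N) : compZ z p = 0 :=
  (homogZ_compZ z p).eq_zero hz

lemma pderiv_comm (q r : Fin N) (p : S N) : pderiv q (pderiv r p) = pderiv r (pderiv q p) := by
  have h : ⁅(pderiv q : Derivation ℂ (S N) (S N)), (pderiv r : Derivation ℂ (S N) (S N))⁆ = 0 := by
    refine MvPolynomial.derivation_ext fun i => ?_
    rw [Derivation.commutator_apply]
    simp [pderiv_X, Pi.single_apply, apply_ite]
  have := congrArg (fun D : Derivation ℂ (S N) (S N) => D p) h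
  rw [Derivation.commutator_apply] at this
  exact sub_eq_zero.1 this

end Grading

section Connection

variable {N : ℕ} {ι : Type} [DecidableEq ι] {F : ι → S N}

/-- `∑_{i ∈ K} a_i (∏_{l ∈ K, l ≠ i} F_l) dF_i`. -/
noncomputable def partialLog (F : ι → S N) (K : Finset ι) (a : ι → ℂ) (p : Fin N) : S N :=
  ∑ i ∈ K, C (a i) * (∏ l ∈ K.erase i, F l) * pderiv p (F i)

/-- The twisted differential `H dP + P (dH + τ)`, where `H = ∏_{i ∈ K} F_i` and `τ` is the
logarithmic form `partialLog F K a`. -/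
noncomputable def twistedD (F : ι → S N) (K : Finset ι) (a : ι → ℂ) (P : S N) (p : Fin N) : S N :=
  (∏ l ∈ K, F l) * pderiv p P + P * (pderiv p (∏ l ∈ K, F l) + partialLog F K a p)

/-- The twisted curl `H dγ + τ ∧ γ`. -/
noncomputable def twistedCurl (F : ι → S N) (K : Finset ι) (a : ι → ℂ) (γ : Fin N → S N)
    (p q : Fin N) : S N :=
  (∏ l ∈ K, F l) * (pderiv p (γ q) - pderiv q (γ p)) +
    (partialLog F K a p * γ q - partialLog F K a q * γ p)

/-- Coefficients of the 3-form `df ∧ (H dγ + τ ∧ γ)`. -/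
noncomputable def twistedEq (f : S N) (F : ι → S N) (K : Finset ι) (a : ι → ℂ) (γ : Fin N → S N)
    (p q r : Fin N) : S N :=
  pderiv p f * twistedCurl F K a γ q r - pderiv q f * twistedCurl F K a γ p r +
    pderiv r f * twistedCurl F K a γ p q

lemma partialLog_erase {K : Finset ι} {s : ι} (hs : s ∈ K) (a : ι → ℂ) (p : Fin N) :
    partialLog F K a p = C (a s) * (∏ l ∈ K.erase s, F l) * pderiv p (F s) +
      F s * partialLog F (K.erase s) a p := by
  rw [partialLog, ← add_sum_erase _ _ hs, partialLog, mul_sum]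
  congr 1
  refine sum_congr rfl fun i hi => ?_
  have : s ∈ K.erase i := mem_erase.2 ⟨(ne_of_mem_erase hi).symm, hs⟩
  rw [← mul_prod_erase _ _ this, erase_right_comm]
  ring

lemma partialLog_congr {K : Finset ι} {a a' : ι → ℂ} (h : ∀ i ∈ K, a i = a' i) (p : Fin N) :
    partialLog F K a p = partialLog F K a' p :=
  sum_congr rfl fun i hi => by rw [h i hi]

lemma partialLog_update {K : Finset ι} {s : ι} (hs : s ∈ K) (a : ι → ℂ) (p : Fin N) :
    partialLog F K (Function.update a s (a s + 1)) p =
      partialLog F K a p + (∏ l ∈ K.erase s, F l) * pderiv p (F s) := by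
  rw [partialLog_erase hs, partialLog_erase hs, partialLog_congr (a' := a)]
  · simp only [Function.update_self, map_add, map_one]
    ring
  · intro i hi
    rw [Function.update_of_ne (ne_of_mem_erase hi)]

lemma prod_mul_curl_partialLog (K : Finset ι) (a : ι → ℂ) (p q : Fin N) :
    (∏ l ∈ K, F l) * (pderiv p (partialLog F K a q) - pderiv q (partialLog F K a p)) =
      pderiv p (∏ l ∈ K, F l) * partialLog F K a q -
        pderiv q (∏ l ∈ K, F l) * partialLog F K a p := by
  simp only [partialLog, map_sum, mul_sum, ← sum_sub_distrib]
  refine sum_congr rfl fun i hi => ?_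
  rw [← mul_prod_erase K F hi]
  simp only [Derivation.leibniz, smul_eq_mul, pderiv_C, pderiv_comm q p (F i)]
  ring

lemma twistedCurl_twistedD (K : Finset ι) (a : ι → ℂ) (P : S N) (p q : Fin N) :
    twistedCurl F K a (twistedD F K a P) p q = 0 := by
  have h := prod_mul_curl_partialLog (F := F) K a p q
  simp only [twistedCurl, twistedD, map_add, Derivation.leibniz, smul_eq_mul, pderiv_comm q p]
  linear_combination P * h

lemma twistedEq_add (f : S N) (K : Finset ι) (a : ι → ℂ) (γ γ' : Fin N → S N) (p q r : Fin N) :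
    twistedEq f F K a (fun k => γ k + γ' k) p q r =
      twistedEq f F K a γ p q r + twistedEq f F K a γ' p q r := by
  simp only [twistedEq, twistedCurl, map_add]
  ring

lemma twistedEq_mul_pderiv (f c : S N) (K : Finset ι) (a : ι → ℂ) (p q r : Fin N) :
    twistedEq f F K a (fun k => c * pderiv k f) p q r = 0 := by
  simp only [twistedEq, twistedCurl, Derivation.leibniz, smul_eq_mul, pderiv_comm r q f,
    pderiv_comm r p f, pderiv_comm q p f]
  ring

lemma twistedEq_twistedD (f P : S N) (K : Finset ι) (a : ι → ℂ) (p q r : Fin N) :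
    twistedEq f F K a (twistedD F K a P) p q r = 0 := by
  simp [twistedEq, twistedCurl_twistedD]

lemma twistedEq_mul (f : S N) {K : Finset ι} {s : ι} (hs : s ∈ K) (a : ι → ℂ) (γ : Fin N → S N)
    (p q r : Fin N) :
    twistedEq f F K a (fun k => F s * γ k) p q r =
      F s * twistedEq f F K (Function.update a s (a s + 1)) γ p q r := by
  simp only [twistedEq, twistedCurl, partialLog_update hs, ← mul_prod_erase K F hs,
    Derivation.leibniz, smul_eq_mul]
  ring

lemma twistedD_mul {K : Finset ι} {s : ι} (hs : s ∈ K) (a : ι → ℂ) (P : S N) (p : Fin N) :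
    twistedD F K a (F s * P) p =
      F s * twistedD F K (Function.update a s (a s + 1)) P p := by
  simp only [twistedD, partialLog_update hs, ← mul_prod_erase K F hs,
    Derivation.leibniz, smul_eq_mul]
  ring

lemma twistedD_add (K : Finset ι) (a : ι → ℂ) (P Q : S N) (p : Fin N) :
    twistedD F K a (P + Q) p = twistedD F K a P p + twistedD F K a Q p := by
  simp only [twistedD, map_add]
  ring

/-- Modulo `F_i`, the equation `twistedEq` reads `df ∧ dF_i ∧ γ = 0`. -/
lemma SNC.wedge3_mem_of_twistedEq (hF : SNC F) (hN : 4 ≤ N) {j : ι} {K : Finset ι} (hj : j ∉ K)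
    {a : ι → ℂ} {γ : Fin N → S N}
    (hE : ∀ p q r, twistedEq (F j) F K a γ p q r ∈ idealOf F {j}) {i : ι} (hi : i ∈ K)
    (hai : a i ≠ 0) (p q r : Fin N) :
    wedge3 (fun c => pderiv c (F j)) (fun c => pderiv c (F i)) γ p q r ∈ idealOf F {j, i} := by
  have hcard : ({j, i} : Finset ι).card ≤ 2 := card_le_two
  refine hF.regular_prod (K := K.erase i) (by omega) ?_ _ ?_
  · rw [disjoint_insert_right, disjoint_singleton_right]
    exact ⟨fun h => hj (mem_of_mem_erase h), notMem_erase i K⟩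
  have h1 : twistedEq (F j) F K a γ p q r ∈ idealOf F {j, i} := by
    rw [pair_comm]; exact idealOf_le_insert (hE p q r)
  have h2 : F i ∈ idealOf F {j, i} := mem_idealOf (by simp)
  have h3 : C (a i) * ((∏ l ∈ K.erase i, F l) *
      wedge3 (fun c => pderiv c (F j)) (fun c => pderiv c (F i)) γ p q r) ∈ idealOf F {j, i} := by
    refine (Submodule.sub_mem_iff_right _ h1).1 (Ideal.mem_of_dvd _ ?_ h2)
    refine ⟨twistedEq (F j) F (K.erase i) a γ p q r, ?_⟩
    simp only [twistedEq, twistedCurl, partialLog_erase hi, ← mul_prod_erase K F hi, wedge3]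
    ring
  have := Ideal.mul_mem_left _ (C (a i)⁻¹) h3
  rwa [← mul_assoc, ← C_mul, inv_mul_cancel₀ hai, C_1, one_mul] at this

end Connection

section Solve

variable {N : ℕ} {ι : Type} {F : ι → S N} {dg : ι → ℕ}

lemma homogZ_prod (hFh : ∀ i, HomogZ (dg i : ℤ) (F i)) (K : Finset ι) :
    HomogZ (∑ i ∈ K, (dg i : ℤ)) (∏ i ∈ K, F i) :=
  IsWeightedHomogeneous.prod K F _ fun i _ => hFh i

variable [DecidableEq ι]

lemma homogZ_partialLog (hFh : ∀ i, HomogZ (dg i : ℤ) (F i)) (K : Finset ι) (a : ι → ℂ)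
    (p : Fin N) : HomogZ (∑ i ∈ K, (dg i : ℤ) - 1) (partialLog F K a p) := by
  refine IsWeightedHomogeneous.sum K _ _ fun i hi => ?_
  refine HomogZ.congr (((homogZ_prod hFh (K.erase i)).C_mul (a i)).mul ((hFh i).pderiv p)) ?_
  rw [← add_sum_erase K _ hi]
  ring

lemma exists_of_mem_idealOf_pair {i j : ι} {x : S N} (hx : x ∈ idealOf F {i, j}) :
    ∃ u v, x = u * F i + v * F j := by
  obtain ⟨u, hu⟩ := mem_idealOf_insert.1 hx
  rw [← insert_empty_eq, mem_idealOf_insert] at hu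
  obtain ⟨v, hv⟩ := hu
  simp only [idealOf, coe_empty, Set.image_empty, Ideal.span_empty, Ideal.mem_bot] at hv
  exact ⟨u, v, by linear_combination hv⟩

/-- Solving `df ∧ (H dγ + τ ∧ γ) = 0` modulo `f`, in degrees below `deg f`. -/
theorem SNC.exists_twistedD (hF : SNC F) (hN : 4 ≤ N) (hdg : ∀ i, 1 ≤ dg i)
    (hFh : ∀ i, HomogZ (dg i : ℤ) (F i)) {j s : ι} {K : Finset ι} (hj : j ∉ K) (hs : s ∈ K)
    (M : ℕ) : ∀ (z : ℤ) (a : ι → ℂ) (γ : Fin N → S N), z < M → z < dg j → (∀ i ∈ K, a i ≠ 0) →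
      (∀ e : ℕ, a s + e ≠ 0) → (∀ p, HomogZ z (γ p)) →
      (∀ p q r, twistedEq (F j) F K a γ p q r ∈ idealOf F {j}) →
      ∃ c P, HomogZ (z - dg j + 1) c ∧ HomogZ (z + 1 - ∑ i ∈ K, (dg i : ℤ)) P ∧
        ∀ p, γ p = c * pderiv p (F j) + twistedD F K a P p := by
  induction M with
  | zero =>
    intro z a γ hz _ _ _ hγ _
    refine ⟨0, 0, isWeightedHomogeneous_zero _ _ _, isWeightedHomogeneous_zero _ _ _, fun p => ?_⟩
    rw [(hγ p).eq_zero (by simpa using hz)]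
    simp [twistedD]
  | succ M ih =>
    intro z a γ hzM hzj ha has hγ hE
    have hjs : j ≠ s := fun h => hj (h ▸ hs)
    have hds := hdg s
    have hwedge := fun i (hi : i ∈ K) => hF.wedge3_mem_of_twistedEq hN hj hE hi (ha i hi)
    -- the homogeneous decomposition `γ = c df + b dF_s + F_s δ`
    obtain ⟨c, b, δ, hc, hb, hδ, hdec⟩ : ∃ (c b : S N) (δ : Fin N → S N), HomogZ (z - dg j + 1) c ∧
        HomogZ (z - dg s + 1) b ∧ (∀ p, HomogZ (z - dg s) (δ p)) ∧
        ∀ p, γ p = c * pderiv p (F j) + b * pderiv p (F s) + δ p * F s := by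
      obtain ⟨c, b, hcb⟩ := hF.division hjs hN γ (hwedge s hs)
      choose ε δ hεδ using fun p => exists_of_mem_idealOf_pair (hcb p)
      refine ⟨compZ (z - dg j + 1) c, compZ (z - dg s + 1) b, fun p => compZ (z - dg s) (δ p),
        homogZ_compZ _ _, homogZ_compZ _ _, fun p => homogZ_compZ _ _, fun p => ?_⟩
      have h1 : γ p = c * pderiv p (F j) + b * pderiv p (F s) + (ε p * F j + δ p * F s) := by
        linear_combination hεδ p
      have h2 := congrArg (compZ z) h1
      rw [compZ_self (hγ p), map_add, map_add, map_add, compZ_mul ((hFh j).pderiv p),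
        compZ_mul ((hFh s).pderiv p), compZ_mul (hFh j), compZ_mul (hFh s),
        compZ_neg (by omega) (ε p), zero_mul, zero_add] at h2
      rw [h2]
      ring_nf
    -- `b` is divisible by the other `F_k` modulo `F_s`
    obtain ⟨b', b'', hb', hb'', hbdec⟩ : ∃ b' b'' : S N,
        HomogZ (z + 1 - ∑ i ∈ K, (dg i : ℤ)) b' ∧ HomogZ (z - 2 * dg s + 1) b'' ∧
        b = b' * (∏ l ∈ K.erase s, F l) + b'' * F s := by
      have hbk : ∀ k ∈ K.erase s, b ∈ idealOf F (insert k {j, s}) := by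
        intro k hk
        have hjk : j ≠ k := fun h => hj (h ▸ mem_of_mem_erase hk)
        have hset : (insert k {j, s} : Finset ι) = {j, k, s} := by
          ext; simp only [mem_insert, mem_singleton]; tauto
        rw [hset]
        refine hF.mem_of_mul_wedge3_mem hjk hjs (ne_of_mem_erase hk) hN b fun p q r => ?_
        have h1 := hwedge k (mem_of_mem_erase hk) p q r
        have h2 : wedge3 (fun c => pderiv c (F j)) (fun c => pderiv c (F k)) γ p q r ∈
            idealOf F {j, k, s} := by
          have := idealOf_le_insert (l := s) h1
          rwa [show (insert s {j, k} : Finset ι) = {j, k, s} by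
            ext; simp only [mem_insert, mem_singleton]; tauto] at this
        refine (Submodule.sub_mem_iff_right _ h2).1
          (Ideal.mem_of_dvd _ ?_ (mem_idealOf (i := s) (by simp)))
        refine ⟨wedge3 (fun c => pderiv c (F j)) (fun c => pderiv c (F k)) δ p q r, ?_⟩
        simp only [wedge3, hdec]
        ring
      have hcard : ({j, s} : Finset ι).card ≤ 2 := card_le_two
      obtain ⟨b', hb'⟩ := hF.mem_of_forall_mem_insert (T := {j, s}) (by omega) (by
        rw [disjoint_insert_right, disjoint_singleton_right]
        exact ⟨fun h => hj (mem_of_mem_erase h), notMem_erase s K⟩) b hbk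
      obtain ⟨u, v, huv⟩ := exists_of_mem_idealOf_pair hb'
      have h1 : b = b' * (∏ l ∈ K.erase s, F l) + (u * F j + v * F s) := by
        linear_combination huv
      have h2 := congrArg (compZ (z - dg s + 1)) h1
      rw [compZ_self hb, map_add, map_add, compZ_mul (homogZ_prod hFh (K.erase s)),
        compZ_mul (hFh j), compZ_mul (hFh s), compZ_neg (by omega) u, zero_mul, zero_add] at h2
      refine ⟨_, _, ?_, ?_, h2⟩
      · refine (homogZ_compZ _ _).congr ?_
        rw [← add_sum_erase K _ hs]
        ring
      · exact (homogZ_compZ _ _).congr (by ring)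
    have has1 : 1 + a s ≠ 0 := by
      have := has 1
      rwa [Nat.cast_one, add_comm] at this
    set P₀ := C (1 + a s)⁻¹ * b' with hP₀
    have hP₀h : HomogZ (z + 1 - ∑ i ∈ K, (dg i : ℤ)) P₀ := hb'.C_mul _
    have hbP : b' = P₀ + C (a s) * P₀ := by
      have : (C (1 + a s) : S N) * C (1 + a s)⁻¹ = 1 := by
        rw [← C_mul, mul_inv_cancel₀ has1, C_1]
      rw [hP₀]
      rw [map_add, C_1] at this
      linear_combination (-b') * this
    set γ₂ : Fin N → S N := fun p => b'' * pderiv p (F s) + δ p -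
      (∏ l ∈ K.erase s, F l) * pderiv p P₀ -
      P₀ * (pderiv p (∏ l ∈ K.erase s, F l) + partialLog F (K.erase s) a p) with hγ₂
    have hγdec : ∀ p, γ p = c * pderiv p (F j) + twistedD F K a P₀ p + F s * γ₂ p := by
      intro p
      rw [hdec p, hbdec, hbP, hγ₂, twistedD, partialLog_erase hs, ← mul_prod_erase K F hs]
      simp only [Derivation.leibniz, smul_eq_mul]
      ring
    have hsumK : (dg s : ℤ) + ∑ i ∈ K.erase s, (dg i : ℤ) = ∑ i ∈ K, (dg i : ℤ) :=
      add_sum_erase K (fun i => (dg i : ℤ)) hs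
    have hγ₂h : ∀ p, HomogZ (z - dg s) (γ₂ p) := by
      intro p
      refine ((IsWeightedHomogeneous.add ?_ (hδ p)).sub ?_).sub ?_
      · exact HomogZ.congr (hb''.mul ((hFh s).pderiv p)) (by ring)
      · refine HomogZ.congr ((homogZ_prod hFh (K.erase s)).mul (hP₀h.pderiv p)) ?_
        rw [← hsumK]; ring
      · refine HomogZ.congr (hP₀h.mul (((homogZ_prod hFh (K.erase s)).pderiv p).add
          (homogZ_partialLog hFh (K.erase s) a p))) ?_
        rw [← hsumK]; ring
    have hE₂ : ∀ p q r, twistedEq (F j) F K (Function.update a s (a s + 1)) γ₂ p q r ∈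
        idealOf F {j} := by
      intro p q r
      refine hF.regular_prod (K := {s}) (by simp; omega) (by simpa using hjs.symm) _ ?_
      rw [prod_singleton, ← twistedEq_mul (F j) hs]
      have h1 := hE p q r
      rw [funext hγdec, twistedEq_add, twistedEq_add, twistedEq_mul_pderiv, twistedEq_twistedD,
        zero_add, zero_add] at h1
      exact h1
    obtain ⟨c₂, P₂, hc₂, hP₂, hdec₂⟩ := ih (z - dg s) _ γ₂ (by push_cast at hzM; omega) (by omega)
      (fun i hi => by
        by_cases h : i = s
        · subst h; rw [Function.update_self, add_comm]; exact has1
        · rw [Function.update_of_ne h]; exact ha i hi)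
      (fun e => by
        rw [Function.update_self]
        have := has (e + 1)
        push_cast at this
        rwa [add_assoc, add_comm 1]) hγ₂h hE₂
    refine ⟨c + F s * c₂, P₀ + F s * P₂, hc.add (HomogZ.congr ((hFh s).mul hc₂) (by ring)),
      hP₀h.add (HomogZ.congr ((hFh s).mul hP₂) (by ring)), fun p => ?_⟩
    rw [hγdec p, hdec₂ p, twistedD_add, twistedD_mul hs]
    ring

end Solve

section Resonance

variable {m : ℕ} {dd : Fin (m+1) → ℕ} {lam : Fin (m+1) → ℂ}

lemma false_of_erase_erase_eq_empty (hd : ∀ i, 1 ≤ dd i) (hlamd : ∑ i, (dd i : ℂ) * lam i = 0)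
    (hres : ∀ e : ℕ, 1 ≤ e → e ≤ dd 0 / (∑ j ∈ Finset.univ.erase 0, dd j) →
      ∀ s : Fin (m+1), s ≠ 0 → (e : ℂ) * lam 0 + lam s ≠ 0)
    {j : Fin (m+1)} (hj : j ≠ 0) (hK : (univ.erase j).erase (0 : Fin (m+1)) = ∅)
    (hdj : dd 0 = dd j) : False := by
  have h0 : (0 : Fin (m+1)) ∈ univ.erase j := mem_erase.2 ⟨hj.symm, mem_univ _⟩
  have hjK : j ∈ univ.erase (0 : Fin (m+1)) := mem_erase.2 ⟨hj, mem_univ _⟩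
  have hdj0 : (dd j : ℂ) ≠ 0 := by
    have := hd j
    exact_mod_cast (by omega : dd j ≠ 0)
  rw [← add_sum_erase _ _ (mem_univ j), ← add_sum_erase _ _ h0, hK, sum_empty, hdj, add_zero,
    ← mul_add, mul_eq_zero, or_iff_right hdj0] at hlamd
  refine hres 1 le_rfl ?_ j hj (by rw [Nat.cast_one, one_mul, add_comm, hlamd])
  rw [← add_sum_erase _ _ hjK, erase_right_comm, hK, sum_empty, hdj, add_zero,
    Nat.div_self (hd j)]

/-- For `j ≠ 0` the degree of `F_j` is less than the degree of `F̂_j`. -/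
lemma lt_sum_erase (hd : ∀ i, 1 ≤ dd i) (hmono : ∀ i j : Fin (m+1), i ≤ j → dd j ≤ dd i)
    (hlamd : ∑ i, (dd i : ℂ) * lam i = 0)
    (hres : ∀ e : ℕ, 1 ≤ e → e ≤ dd 0 / (∑ j ∈ Finset.univ.erase 0, dd j) →
      ∀ s : Fin (m+1), s ≠ 0 → (e : ℂ) * lam 0 + lam s ≠ 0)
    {j : Fin (m+1)} (hj : j ≠ 0) : dd j < ∑ i ∈ univ.erase j, dd i := by
  have h0 : (0 : Fin (m+1)) ∈ univ.erase j := mem_erase.2 ⟨hj.symm, mem_univ _⟩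
  have h1 := hmono 0 j (Fin.zero_le j)
  rw [← add_sum_erase _ _ h0]
  by_contra hlt
  have h2 : ∑ i ∈ (univ.erase j).erase 0, dd i = 0 := by omega
  refine false_of_erase_erase_eq_empty hd hlamd hres hj ?_ (by omega)
  refine eq_empty_of_forall_notMem fun i hi => ?_
  have := (sum_eq_zero_iff.1 h2) i hi
  have := hd i
  omega

/-- For every `j` some ratio `λ_s / λ_j` is not a nonpositive integer. -/
lemma exists_not_resonant (hd : ∀ i, 1 ≤ dd i)
    (hmono : ∀ i j : Fin (m+1), i ≤ j → dd j ≤ dd i) (hlam0 : ∀ i, lam i ≠ 0)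
    (hlamd : ∑ i, (dd i : ℂ) * lam i = 0)
    (hres : ∀ e : ℕ, 1 ≤ e → e ≤ dd 0 / (∑ j ∈ Finset.univ.erase 0, dd j) →
      ∀ s : Fin (m+1), s ≠ 0 → (e : ℂ) * lam 0 + lam s ≠ 0) (j : Fin (m+1)) :
    ∃ s ∈ univ.erase j, ∀ e : ℕ, lam s / lam j + e ≠ 0 := by
  by_contra hcon
  push Not at hcon
  choose! e he using hcon
  have he' : ∀ s ∈ univ.erase j, e s * lam j + lam s = 0 := fun s hs => by
    have h1 := he s hs
    field_simp [hlam0 j] at h1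
    linear_combination h1
  have he1 : ∀ s ∈ univ.erase j, 1 ≤ e s := fun s hs => by
    by_contra h
    have h1 := he' s hs
    rw [show e s = 0 by omega] at h1
    exact hlam0 s (by simpa using h1)
  have hdj : dd j = ∑ s ∈ univ.erase j, dd s * e s := by
    have h1 : lam j * ((dd j : ℂ) - ∑ s ∈ univ.erase j, (dd s : ℂ) * e s) = 0 := by
      rw [← hlamd, ← add_sum_erase _ _ (mem_univ j), mul_sub, sub_eq_add_neg, mul_sum,
        ← sum_neg_distrib]
      congr 1
      · ring
      · exact sum_congr rfl fun s hs => by linear_combination (-(dd s : ℂ)) * he' s hs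
    have h2 := sub_eq_zero.1 ((mul_eq_zero.1 h1).resolve_left (hlam0 j))
    exact_mod_cast h2
  have hle : ∑ s ∈ univ.erase j, dd s ≤ dd j := by
    rw [hdj]
    exact sum_le_sum fun s hs => Nat.le_mul_of_pos_right _ (he1 s hs)
  by_cases hj : j = 0
  · subst hj
    set D := ∑ s ∈ univ.erase (0 : Fin (m+1)), dd s with hD
    have h1 : D * (dd 0 / D + 1) ≤ dd 0 := by
      conv_rhs => rw [hdj]
      rw [hD, sum_mul]
      refine sum_le_sum fun s hs => Nat.mul_le_mul_left _ ?_
      by_contra h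
      exact hres (e s) (he1 s hs) (Nat.lt_succ_iff.1 (not_le.1 h)) s (ne_of_mem_erase hs) (he' s hs)
    have hDpos : 0 < D := by
      by_contra h
      have h2 : dd 0 = 0 := by
        rw [hdj]
        refine sum_eq_zero fun s hs => ?_
        rw [(sum_eq_zero_iff.1 (show D = 0 by omega)) s hs, zero_mul]
      have := hd 0
      omega
    have := Nat.lt_mul_div_succ (dd 0) hDpos
    omega
  · have := lt_sum_erase hd hmono hlamd hres hj
    omega

end Resonance

section Tangent

variable {N m : ℕ} {F : Fin m → S N}

lemma GeneralPosition.snc (h : GeneralPosition F) : SNC F := by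
  intro x hx U hU
  exact (h.2 x hx).comp (fun i : U => (⟨i.1, hU i.1 i.2⟩ : {i // eval x (F i) = 0}))
    fun i i' hii => Subtype.ext (congrArg (fun t => t.1) hii)

lemma Fhat_eq_mul {i j : Fin m} (hij : i ≠ j) :
    Fhat F i = F j * ∏ l ∈ (univ.erase j).erase i, F l := by
  rw [Fhat, ← mul_prod_erase _ _ (mem_erase.2 ⟨hij.symm, mem_univ j⟩), erase_right_comm]

lemma logForm_eq (lam : Fin m → ℂ) (j : Fin m) :
    logForm lam F = fun k => C (lam j) * Fhat F j * pderiv k (F j) +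
      F j * partialLog F (univ.erase j) lam k := by
  funext k
  rw [logForm, ← add_sum_erase _ _ (mem_univ j), partialLog, mul_sum]
  congr 1
  refine sum_congr rfl fun i hi => ?_
  rw [Fhat_eq_mul (ne_of_mem_erase hi)]
  ring

lemma partialLog_C_mul {ι : Type} [DecidableEq ι] (F : ι → S N) (K : Finset ι) (c : ℂ)
    (a : ι → ℂ) (p : Fin N) :
    partialLog F K (fun i => c * a i) p = C c * partialLog F K a p := by
  simp only [partialLog, mul_sum, C_mul]
  exact sum_congr rfl fun i _ => by ring

/-- Expansion of `ω ∧ dα + α ∧ dω` modulo `f`, for `ω = l H df + f σ` and `α = H γ + f β`. -/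
lemma tangent_expand (l : ℂ) (f H : S N) (σ γ β : Form1 N) (p q r : Fin N) :
    w12 (fun k => C l * H * pderiv k f + f * σ k) (extD fun k => H * γ k + f * β k) p q r +
      w12 (fun k => H * γ k + f * β k) (extD fun k => C l * H * pderiv k f + f * σ k) p q r =
    H * w12 (fun k => pderiv k f)
      (fun u v => C l * H * extD γ u v + w11 σ γ u v) p q r +
    f * (w12 (fun k => C l * H * pderiv k f) (extD β) p q r +
      w12 σ (extD fun k => H * γ k + f * β k) p q r +
      w12 β (extD fun k => C l * H * pderiv k f + f * σ k) p q r +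
      w12 (fun k => H * γ k) (extD σ) p q r) := by
  simp only [w12, w11, extD, map_add, Derivation.leibniz, smul_eq_mul, pderiv_C,
    pderiv_comm r q f, pderiv_comm r p f, pderiv_comm q p f]
  ring

lemma TangentZero.twistedEq_mem (hF : SNC F) (hN : 4 ≤ N) {lam : Fin m → ℂ}
    {α : Form1 N} {γ : Fin m → Form1 N} (ht : TangentZero (logForm lam F) α)
    (hαγ : ∀ k, α k = ∑ i, Fhat F i * γ i k) (j : Fin m) (hlj : lam j ≠ 0) (p q r : Fin N) :
    twistedEq (F j) F (univ.erase j) (fun i => lam i / lam j) (γ j) p q r ∈ idealOf F {j} := by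
  have hα : α = fun k => Fhat F j * γ j k + F j *
      ∑ i ∈ univ.erase j, (∏ l ∈ (univ.erase j).erase i, F l) * γ i k := by
    funext k
    rw [hαγ, ← add_sum_erase _ _ (mem_univ j), mul_sum]
    congr 1
    refine sum_congr rfl fun i hi => ?_
    rw [Fhat_eq_mul (ne_of_mem_erase hi), mul_assoc]
  have h1 := ht p q r
  rw [logForm_eq lam j, hα, tangent_expand] at h1
  refine hF.regular_prod (K := univ.erase j) (by simp; omega) (by simp) _ ?_
  have hσ : ∀ k, partialLog F (univ.erase j) lam k =
      C (lam j) * partialLog F (univ.erase j) (fun i => lam i / lam j) k := by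
    intro k
    rw [← partialLog_C_mul]
    exact partialLog_congr (fun i _ => by field_simp) k
  have h2 : C (lam j) * ((∏ l ∈ univ.erase j, F l) *
      twistedEq (F j) F (univ.erase j) (fun i => lam i / lam j) (γ j) p q r) ∈ idealOf F {j} := by
    rw [add_eq_zero_iff_eq_neg, ← mul_neg] at h1
    have h3 : ∀ x y : S N, x = F j * y → x ∈ idealOf F {j} := fun x y h =>
      h ▸ Ideal.mul_mem_right _ _ (mem_idealOf (mem_singleton_self j))
    convert h3 _ _ h1 using 1
    simp only [w12, w11, extD, twistedEq, twistedCurl, hσ, Fhat]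
    ring
  have h3 := Ideal.mul_mem_left _ (C (lam j)⁻¹) h2
  rwa [← mul_assoc, ← C_mul, inv_mul_cancel₀ hlj, C_1, one_mul] at h3

end Tangent

section Assembly

variable {N : ℕ}

lemma HomogZ.radial_eq {z : ℤ} {p : S N} (hp : HomogZ z p) :
    radial (fun k => MvPolynomial.pderiv k p) = C (z : ℂ) * p := by
  rcases lt_or_ge z 0 with hz | hz
  · simp [hp.eq_zero hz, radial]
  · lift z to ℕ using hz
    rw [radial, (homogZ_natCast.1 hp).sum_X_mul_pderiv, nsmul_eq_mul]
    simp

lemma radial_add (α β : Form1 N) : radial (fun k => α k + β k) = radial α + radial β := by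
  simp only [radial, mul_add, sum_add_distrib]

lemma radial_mul (h : S N) (α : Form1 N) : radial (fun k => h * α k) = h * radial α := by
  simp only [radial, mul_sum]
  exact sum_congr rfl fun k _ => by ring

lemma radial_sum {ι : Type} (K : Finset ι) (α : ι → Form1 N) :
    radial (fun k => ∑ i ∈ K, α i k) = ∑ i ∈ K, radial (α i) := by
  simp only [radial, mul_sum]
  exact sum_comm

lemma radial_partialLog {ι : Type} [DecidableEq ι] {F : ι → S N} {dg : ι → ℕ}
    (hFh : ∀ i, HomogZ (dg i : ℤ) (F i)) (K : Finset ι) (a : ι → ℂ) :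
    radial (partialLog F K a) = C (∑ i ∈ K, a i * dg i) * ∏ i ∈ K, F i := by
  change radial (fun k => ∑ i ∈ K, C (a i) * (∏ l ∈ K.erase i, F l) * pderiv k (F i)) = _
  rw [radial_sum, map_sum, sum_mul]
  refine sum_congr rfl fun i hi => ?_
  rw [radial_mul, (hFh i).radial_eq, ← mul_prod_erase K F hi, C_mul]
  push_cast
  ring

lemma radial_twistedD {ι : Type} [DecidableEq ι] {F : ι → S N} {dg : ι → ℕ}
    (hFh : ∀ i, HomogZ (dg i : ℤ) (F i)) (K : Finset ι) (a : ι → ℂ) {z : ℤ} {P : S N}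
    (hP : HomogZ z P) :
    radial (twistedD F K a P) =
      C (z + ∑ i ∈ K, (dg i : ℂ) + ∑ i ∈ K, a i * dg i) * ((∏ i ∈ K, F i) * P) := by
  change radial (fun k => (∏ l ∈ K, F l) * pderiv k P +
    P * (pderiv k (∏ l ∈ K, F l) + partialLog F K a k)) = _
  rw [radial_add, radial_mul, radial_mul, radial_add, hP.radial_eq,
    (homogZ_prod hFh K).radial_eq, radial_partialLog hFh]
  simp only [C_add]
  push_cast
  ring

lemma HomogZ.eq_C {p : S N} (hp : HomogZ 0 p) : p = C (coeff 0 p) := by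
  have h : p.IsHomogeneous 0 := homogZ_natCast.1 (HomogZ.congr hp Nat.cast_zero.symm)
  rwa [← totalDegree_zero_iff_isHomogeneous, totalDegree_eq_zero_iff_eq_C] at h

/-- `dμ(λ, F)` in a direction varying `λ` and `F₀` only. -/
lemma dmu_single {m : ℕ} (lam lam' : Fin (m+1) → ℂ) (F : Fin (m+1) → S N) (T : S N) (k : Fin N) :
    dmu lam F lam' (fun i => if i = 0 then T else 0) k =
      ∑ i, C (lam' i) * Fhat F i * pderiv k (F i) + T * partialLog F (univ.erase 0) lam k +
        C (lam 0) * Fhat F 0 * pderiv k T := by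
  rw [dmu]
  congr 1
  · congr 1
    rw [← add_sum_erase _ _ (mem_univ (0 : Fin (m+1))), partialLog, mul_sum,
      sum_eq_zero (fun j hj => by simp [ne_of_mem_erase hj]), zero_add]
    refine sum_congr rfl fun i hi => ?_
    rw [sum_eq_single_of_mem (0 : Fin (m+1))
      (mem_erase.2 ⟨(ne_of_mem_erase hi).symm, mem_univ _⟩) (fun j _ hj => by simp [hj]),
      if_pos rfl, Fhat2, erase_right_comm]
    ring
  · rw [sum_eq_single (0 : Fin (m+1)) (fun j _ hj => by simp [hj]) (by simp), if_pos rfl]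

end Assembly

/-- General (possibly unbalanced) case, with `m + 1` polynomials, `d₁ = dd 0` the
largest degree, `d̂₁ = ∑_{j≠0} dⱼ` and `r(𝐝) = ⌊d₁/d̂₁⌋`: any `α ∈ T(ω)` of the form
`∑ F̂ᵢ γᵢ` equals `dμ(λ,F)(λ',F')` with `∑ dᵢ λ'ᵢ = 0`, `F'ⱼ = 0` for `j ≠ 0` and
`F'₀ = ∑_{e=1}^{r(𝐝)} G_e F̂₀^e` with `G_e` homogeneous of degree `d₁ - e·d̂₁`. -/
theorem statement18 (n m d : ℕ) (hn : 3 ≤ n) (dd : Fin (m+1) → ℕ) (lam : Fin (m+1) → ℂ)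
    (F : Fin (m+1) → S (n+1))
    (hd : ∀ i, 1 ≤ dd i) (hsum : ∑ i, dd i = d)
    (hmono : ∀ i j : Fin (m+1), i ≤ j → dd j ≤ dd i)
    (hFh : ∀ i, (F i).IsHomogeneous (dd i)) (hgen : GeneralPosition F)
    (hlam : ∀ i j, i ≠ j → lam i ≠ lam j) (hlam0 : ∀ i, lam i ≠ 0)
    (hlamd : ∑ i, (dd i : ℂ) * lam i = 0)
    (hres : ∀ e : ℕ, 1 ≤ e → e ≤ dd 0 / (∑ j ∈ Finset.univ.erase 0, dd j) →
      ∀ s : Fin (m+1), s ≠ 0 → (e : ℂ) * lam 0 + lam s ≠ 0)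
    (α : Form1 (n+1)) (hαh : IsHomog1 α d) (hαp : radial α = 0)
    (ht : TangentZero (logForm lam F) α)
    (γ : Fin (m+1) → Form1 (n+1)) (hγ : ∀ i, IsHomog1 (γ i) (dd i))
    (hαγ : ∀ k, α k = ∑ i, Fhat F i * γ i k) :
    ∃ lam' : Fin (m+1) → ℂ, ∃ G : ℕ → S (n+1),
      (∑ i, (dd i : ℂ) * lam' i = 0) ∧
      (∀ e ∈ Finset.Icc 1 (dd 0 / (∑ j ∈ Finset.univ.erase 0, dd j)),
        (G e).IsHomogeneous (dd 0 - e * (∑ j ∈ Finset.univ.erase 0, dd j))) ∧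
      α = dmu lam F lam'
        (fun i => if i = 0 then
            ∑ e ∈ Finset.Icc 1 (dd 0 / (∑ j ∈ Finset.univ.erase 0, dd j)),
              G e * (Fhat F 0) ^ e
          else 0) := by
  have hF : SNC F := hgen.snc
  have hFZ : ∀ i, HomogZ (dd i : ℤ) (F i) := fun i => homogZ_natCast.2 (hFh i)
  have hsolve : ∀ j, ∃ c P, HomogZ 0 c ∧ HomogZ (dd j - ∑ i ∈ univ.erase j, (dd i : ℤ)) P ∧
      ∀ p, γ j p = c * pderiv p (F j) +
        twistedD F (univ.erase j) (fun i => lam i / lam j) P p := by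
    intro j
    obtain ⟨s, hs, hsj⟩ := exists_not_resonant hd hmono hlam0 hlamd hres j
    obtain ⟨c, P, hc, hP, h⟩ := hF.exists_twistedD (by omega) hd hFZ (notMem_erase j univ) hs
      (dd j) (dd j - 1) (fun i => lam i / lam j) (γ j) (by omega) (by omega)
      (fun i _ => div_ne_zero (hlam0 i) (hlam0 j)) hsj
      (fun p => (homogZ_natCast.2 (hγ j p)).congr (by have := hd j; omega))
      (ht.twistedEq_mem hF (by omega) hαγ j (hlam0 j))
    exact ⟨c, P, hc.congr (by ring), hP.congr (by ring), h⟩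
  choose c P hc hP hγP using hsolve
  have hPj : ∀ j, j ≠ 0 → P j = 0 := fun j hj => by
    have := lt_sum_erase hd hmono hlamd hres hj
    refine (hP j).eq_zero ?_
    rw [← Nat.cast_sum]
    omega
  have hα : ∀ k, α k = ∑ i, C (coeff 0 (c i)) * Fhat F i * pderiv k (F i) +
      Fhat F 0 * twistedD F (univ.erase 0) (fun i => lam i / lam 0) (P 0) k := by
    intro k
    have h1 : ∑ i, Fhat F i * twistedD F (univ.erase i) (fun l => lam l / lam i) (P i) k =
        Fhat F 0 * twistedD F (univ.erase 0) (fun i => lam i / lam 0) (P 0) k :=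
      sum_eq_single 0 (fun j _ hj => by simp [hPj j hj, twistedD]) (by simp)
    rw [hαγ, ← h1, ← sum_add_distrib]
    refine sum_congr rfl fun i _ => ?_
    rw [hγP i k, ← (hc i).eq_C]
    ring
  set D := ∑ j ∈ univ.erase (0 : Fin (m+1)), dd j with hD
  have hPD : HomogZ ((dd 0 : ℤ) - D) (P 0) := (hP 0).congr (by rw [hD, Nat.cast_sum])
  set T := C (lam 0)⁻¹ * P 0 * Fhat F 0 with hT
  have hTsum : ∑ e ∈ Icc 1 (dd 0 / D), (if e = 1 then C (lam 0)⁻¹ * P 0 else 0) * Fhat F 0 ^ e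
      = T := by
    by_cases hr : 1 ≤ dd 0 / D
    · rw [sum_eq_single_of_mem 1 (mem_Icc.2 ⟨le_rfl, hr⟩) (fun e _ he => by simp [he]),
        if_pos rfl, pow_one]
    · have hlt : dd 0 < D := by
        have hDpos : 0 < D := by
          obtain ⟨s, hs, -⟩ := exists_not_resonant hd hmono hlam0 hlamd hres 0
          exact (hd s).trans (single_le_sum (f := dd) (fun _ _ => Nat.zero_le _) hs)
        by_contra h
        exact hr (Nat.div_pos (not_lt.1 h) hDpos)
      rw [hT, hPD.eq_zero (by omega)]
      simp
  have hl0 : (C (lam 0) : S (n+1)) * C (lam 0)⁻¹ = 1 := by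
    rw [← C_mul, mul_inv_cancel₀ (hlam0 0), C_1]
  refine ⟨fun i => coeff 0 (c i), fun e => if e = 1 then C (lam 0)⁻¹ * P 0 else 0, ?_, ?_, ?_⟩
  · have hprod : ∏ i, F i ≠ 0 := prod_ne_zero_iff.2 fun i _ => (hgen.1 i).ne_zero
    have h1 : radial (twistedD F (univ.erase 0) (fun i => lam i / lam 0) (P 0)) = 0 := by
      rw [radial_twistedD hFZ _ _ hPD]
      have h2 : (((dd 0 : ℤ) - (D : ℤ) : ℤ) : ℂ) + ∑ i ∈ univ.erase 0, (dd i : ℂ) +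
          ∑ i ∈ univ.erase 0, lam i / lam 0 * dd i = 0 := by
        rw [← add_sum_erase _ _ (mem_univ (0 : Fin (m+1)))] at hlamd
        have h3 : ∑ i ∈ univ.erase 0, lam i / lam 0 * dd i =
            (lam 0)⁻¹ * ∑ i ∈ univ.erase 0, (dd i : ℂ) * lam i := by
          rw [mul_sum]
          exact sum_congr rfl fun i _ => by ring
        have h4 := mul_inv_cancel₀ (hlam0 0)
        rw [h3, hD]
        push_cast
        linear_combination (lam 0)⁻¹ * hlamd - (dd 0 : ℂ) * h4
      rw [h2, C_0, zero_mul]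
    have h2 : C (∑ i, (dd i : ℂ) * coeff 0 (c i)) * ∏ i, F i = 0 := by
      rw [← hαp, funext hα, radial_add, radial_mul, h1, mul_zero, add_zero, radial_sum, map_sum,
        sum_mul]
      refine sum_congr rfl fun i _ => ?_
      rw [radial_mul, (hFZ i).radial_eq, ← mul_prod_erase univ F (mem_univ i), Fhat, C_mul]
      push_cast
      ring
    exact C_eq_zero.1 ((mul_eq_zero.1 h2).resolve_right hprod)
  · intro e he
    obtain ⟨he1, he2⟩ := mem_Icc.1 he
    beta_reduce
    split_ifs with h
    · subst h
      have hle : D ≤ dd 0 := by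
        by_contra hlt
        rw [Nat.div_eq_of_lt (not_le.1 hlt)] at he2
        omega
      refine homogZ_natCast.1 (HomogZ.congr (hPD.C_mul _) ?_)
      omega
    · exact isHomogeneous_zero _ _ _
  · rw [hTsum]
    funext k
    have h3 : partialLog F (univ.erase 0) lam k =
        C (lam 0) * partialLog F (univ.erase 0) (fun i => lam i / lam 0) k := by
      rw [← partialLog_C_mul]
      exact partialLog_congr (fun i _ => by rw [mul_div_cancel₀ _ (hlam0 0)]) k
    rw [dmu_single, hα, h3, hT, twistedD]
    simp only [Derivation.leibniz, smul_eq_mul, pderiv_C, Fhat]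
    linear_combination (-(∏ l ∈ univ.erase 0, F l) * (P 0 * pderiv k (∏ l ∈ univ.erase 0, F l) +
      (∏ l ∈ univ.erase 0, F l) * pderiv k (P 0) +
      P 0 * partialLog F (univ.erase 0) (fun i => lam i / lam 0) k)) * hl0

end LogStab
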